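/- arXiv:2405.00405 — 7 statements merged into one kernel-verified Lean document; each statement's English description precedes it below -/
import Mathlib

section
/- For every such parametrized family of density matrices and every x, the derivative ρ'(x) vanishes on the kernel block: Π_k(x) ρ'(x) Π_k(x) = 0, i.e. ⟨v, ρ'(x) w⟩ = 0 for all vectors v, w orthogonal to span{φ_1(x), …, φ_r(x)}. -/
open Matrix
open scoped Classical

/-- The rank-one matrix `|v⟩⟨w|`, sending `u` to `⟨w, u⟩ v`. -/
noncomputable def ketbra {n : Type*} (v w : n → ℂ) : Matrix n n ℂ :=
  Matrix.vecMulVec v (star w)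

theorem HasDerivAt.const_dotProduct {n : Type*} [Fintype n] (v : n → ℂ)
    {f : ℝ → n → ℂ} {f' : n → ℂ} {x : ℝ} (hf : ∀ i, HasDerivAt (fun y => f y i) (f' i) x) :
    HasDerivAt (fun y => v ⬝ᵥ f y) (v ⬝ᵥ f') x := by
  simpa only [dotProduct] using HasDerivAt.fun_sum fun i _ => (hf i).const_mul (v i)

theorem dotProduct_ketbra_mulVec {n : Type*} [Fintype n] (u v w z : n → ℂ) :
    u ⬝ᵥ (ketbra v w *ᵥ z) = (u ⬝ᵥ v) * (star w ⬝ᵥ z) := by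
  rw [ketbra, vecMulVec_mulVec, dotProduct_smul]
  simp

/-- For a parametrized family of density matrices in spectral form
`ρ(x) = ∑ₙ qₙ(x) |φₙ(x)⟩⟨φₙ(x)|` (with `φₙ(x)` orthonormal, `qₙ(x) > 0`, `∑ₙ qₙ(x) = 1`,
all data differentiable), the derivative `ρ'(x)` vanishes on the kernel block:
`⟨v, ρ'(x) w⟩ = 0` for all `v, w` orthogonal to `span{φ₁(x), …, φᵣ(x)}`. -/
theorem kernel_block_of_deriv_vanishes
    {d r : ℕ}
    (ρ : ℝ → Matrix (Fin d) (Fin d) ℂ)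
    (q : Fin r → ℝ → ℝ) (φ : Fin r → ℝ → Fin d → ℂ)
    (hortho : ∀ x m n, star (φ m x) ⬝ᵥ φ n x = if m = n then 1 else 0)
    (hqpos : ∀ x n, 0 < q n x)
    (hqsum : ∀ x, ∑ n, q n x = 1)
    (hspec : ∀ x, ρ x = ∑ n, (q n x : ℂ) • ketbra (φ n x) (φ n x))
    (q' : Fin r → ℝ → ℝ) (hq' : ∀ n x, HasDerivAt (q n) (q' n x) x)
    (φ' : Fin r → ℝ → Fin d → ℂ)
    (hφ' : ∀ n x i, HasDerivAt (fun y => φ n y i) (φ' n x i) x)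
    (ρ' : ℝ → Matrix (Fin d) (Fin d) ℂ)
    (hρ' : ∀ x i j, HasDerivAt (fun y => ρ y i j) (ρ' x i j) x) :
    ∀ (x : ℝ) (v w : Fin d → ℂ),
      (∀ n, star (φ n x) ⬝ᵥ v = 0) → (∀ n, star (φ n x) ⬝ᵥ w = 0) →
      star v ⬝ᵥ (ρ' x *ᵥ w) = 0 := by
  intro x v w hv hw
  have hvφ : ∀ n, star v ⬝ᵥ φ n x = 0 := fun n => by
    rw [star_dotProduct, hv n, star_zero]
  have h₁ : HasDerivAt (fun y => star v ⬝ᵥ (ρ y *ᵥ w)) (star v ⬝ᵥ (ρ' x *ᵥ w)) x := by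
    refine HasDerivAt.const_dotProduct _ fun i => ?_
    simp only [mulVec, dotProduct_comm _ w]
    exact HasDerivAt.const_dotProduct w fun j => hρ' x i j
  have h₂ : (fun y => star v ⬝ᵥ (ρ y *ᵥ w)) =
      fun y => ∑ n, (q n y : ℂ) * ((star v ⬝ᵥ φ n y) * (w ⬝ᵥ star (φ n y))) := by
    funext y
    simp only [hspec, sum_mulVec, dotProduct_sum, smul_mulVec, dotProduct_smul, smul_eq_mul,
      dotProduct_ketbra_mulVec, dotProduct_comm w]
  rw [h₂] at h₁
  have h₃ := HasDerivAt.fun_sum (u := Finset.univ) fun n _ =>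
    (hq' n x).ofReal_comp.mul
      ((HasDerivAt.const_dotProduct (star v) (hφ' n x)).mul
        (HasDerivAt.const_dotProduct w (f := fun y => star (φ n y)) fun i => (hφ' n x i).star))
  rw [h₁.unique h₃]
  refine Finset.sum_eq_zero fun n _ => ?_
  simp [hvφ n, dotProduct_comm w, hw n]
end

section
/- For every such parametrized family of density matrices, every x, and every λ ∈ (0,1), the postselection POVM element E_✓(x) = Π_k(x) + λ Π_r(x) satisfies Tr[E_✓(x) ρ'(x)] = 0. -/
open Matrix
open scoped Classical

theorem ketbra_mul_ketbra {n : Type*} [Fintype n] (a b c d : n → ℂ) :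
    ketbra a b * ketbra c d = (star b ⬝ᵥ c) • ketbra a d := by
  simp [ketbra, Matrix.vecMulVec_mul_vecMulVec, Matrix.vecMulVec_smul]

theorem trace_ketbra {n : Type*} [Fintype n] (a b : n → ℂ) :
    (ketbra a b).trace = star b ⬝ᵥ a := by
  rw [ketbra, Matrix.trace_vecMulVec, dotProduct_comm]

/-- Entrywise product rule for matrix-valued functions. -/
theorem hasDerivAt_matrix_mul_apply {l m n : Type*} [Fintype m]
    {A : ℝ → Matrix l m ℂ} {B : ℝ → Matrix m n ℂ} {A' : Matrix l m ℂ} {B' : Matrix m n ℂ} {x : ℝ}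
    (hA : ∀ i j, HasDerivAt (fun y => A y i j) (A' i j) x)
    (hB : ∀ i j, HasDerivAt (fun y => B y i j) (B' i j) x) (i : l) (j : n) :
    HasDerivAt (fun y => (A y * B y) i j) ((A' * B x + A x * B') i j) x := by
  simp only [Matrix.add_apply, Matrix.mul_apply, ← Finset.sum_add_distrib]
  exact HasDerivAt.fun_sum fun k _ => (hA i k).mul (hB k j)

/-- Along a differentiable family of idempotents `P` with `P ρ = ρ = ρ P`, the trace of `P ρ'`
is the trace of `ρ'`. -/
theorem trace_mul_deriv_eq_trace_deriv {n : Type*} [Fintype n]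
    {P ρ : ℝ → Matrix n n ℂ} {P' ρ' : Matrix n n ℂ} {x : ℝ}
    (hP : ∀ i j, HasDerivAt (fun y => P y i j) (P' i j) x)
    (hρ : ∀ i j, HasDerivAt (fun y => ρ y i j) (ρ' i j) x)
    (hPP : ∀ y, P y * P y = P y) (hPρ : ∀ y, P y * ρ y = ρ y) (hρP : ∀ y, ρ y * P y = ρ y) :
    (P x * ρ').trace = ρ'.trace := by
  have h₁ : P' * P x + P x * P' = P' := by
    ext i j
    have h := hasDerivAt_matrix_mul_apply hP hP i j
    simp only [hPP] at h
    exact h.unique (hP i j)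
  have h₂ : P' * ρ x + P x * ρ' = ρ' := by
    ext i j
    have h := hasDerivAt_matrix_mul_apply hP hρ i j
    simp only [hPρ] at h
    exact h.unique (hρ i j)
  have h₃ : P x * P' * P x = 0 := by
    have h := congrArg (fun M => P x * M) h₁
    simpa only [Matrix.mul_add, ← Matrix.mul_assoc, hPP, add_eq_right] using h
  have h₄ : (P' * ρ x).trace = 0 := by
    calc (P' * ρ x).trace = (P' * (P x * ρ x * P x)).trace := by rw [hPρ, hρP]
      _ = (P x * P' * P x * ρ x).trace := by
        rw [← Matrix.mul_assoc, Matrix.trace_mul_comm]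
        simp only [Matrix.mul_assoc]
      _ = 0 := by rw [h₃, Matrix.zero_mul, Matrix.trace_zero]
  have h := congrArg Matrix.trace h₂
  rwa [Matrix.trace_add, h₄, zero_add] at h

/-- For a parametrized family of density matrices in spectral form
`ρ(x) = ∑ₙ qₙ(x) |φₙ(x)⟩⟨φₙ(x)|` (with `φₙ(x)` orthonormal, `qₙ(x) > 0`, `∑ₙ qₙ(x) = 1`,
all data differentiable), for every `x` and every `λ ∈ (0,1)` the postselection POVM element
`E_✓(x) = Π_k(x) + λ Π_r(x)` satisfies `Tr[E_✓(x) ρ'(x)] = 0`, where `Π_r(x)` is the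
orthogonal projection onto `span{φ₁(x), …, φᵣ(x)}` and `Π_k(x) = I − Π_r(x)`. -/
theorem trace_povm_deriv_eq_zero
    {d r : ℕ}
    (ρ : ℝ → Matrix (Fin d) (Fin d) ℂ)
    (q : Fin r → ℝ → ℝ) (φ : Fin r → ℝ → Fin d → ℂ)
    (hortho : ∀ x m n, star (φ m x) ⬝ᵥ φ n x = if m = n then 1 else 0)
    (hqpos : ∀ x n, 0 < q n x)
    (hqsum : ∀ x, ∑ n, q n x = 1)
    (hspec : ∀ x, ρ x = ∑ n, (q n x : ℂ) • ketbra (φ n x) (φ n x))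
    (q' : Fin r → ℝ → ℝ) (hq' : ∀ n x, HasDerivAt (q n) (q' n x) x)
    (φ' : Fin r → ℝ → Fin d → ℂ)
    (hφ' : ∀ n x i, HasDerivAt (fun y => φ n y i) (φ' n x i) x)
    (ρ' : ℝ → Matrix (Fin d) (Fin d) ℂ)
    (hρ' : ∀ x i j, HasDerivAt (fun y => ρ y i j) (ρ' x i j) x)
    (Pr Pk : ℝ → Matrix (Fin d) (Fin d) ℂ)
    (hPr : ∀ x, Pr x = ∑ n, ketbra (φ n x) (φ n x))
    (hPk : ∀ x, Pk x = 1 - Pr x) :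
    ∀ (x lam : ℝ), lam ∈ Set.Ioo (0 : ℝ) 1 →
      ((Pk x + (lam : ℂ) • Pr x) * ρ' x).trace = 0 := by
  intro x lam _
  have hP' : ∀ i j, HasDerivAt (fun y => Pr y i j)
      ((∑ n, (ketbra (φ' n x) (φ n x) + ketbra (φ n x) (φ' n x))) i j) x := by
    intro i j
    simp only [hPr, Matrix.sum_apply, Matrix.add_apply, ketbra, Matrix.vecMulVec_apply,
      Pi.star_apply]
    exact HasDerivAt.fun_sum fun n _ => (hφ' n x i).mul (hφ' n x j).star
  have hPP : ∀ y, Pr y * Pr y = Pr y := fun y => by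
    simp [hPr, Finset.sum_mul, Finset.mul_sum, ketbra_mul_ketbra, hortho]
  have hPρ : ∀ y, Pr y * ρ y = ρ y := fun y => by
    simp [hPr, hspec, Finset.sum_mul, Finset.mul_sum, ketbra_mul_ketbra, hortho]
  have hρP : ∀ y, ρ y * Pr y = ρ y := fun y => by
    simp [hPr, hspec, Finset.sum_mul, Finset.mul_sum, ketbra_mul_ketbra, hortho]
  have htr : ∀ y, (ρ y).trace = 1 := fun y => by
    simp only [hspec, Matrix.trace_sum, Matrix.trace_smul, trace_ketbra, hortho, if_true,
      smul_eq_mul, mul_one]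
    exact_mod_cast hqsum y
  have htr' : (ρ' x).trace = 0 := by
    have h : HasDerivAt (fun y => (ρ y).trace) (ρ' x).trace x :=
      HasDerivAt.fun_sum fun i _ => hρ' x i i
    simp only [htr] at h
    exact h.unique (hasDerivAt_const x 1)
  have hPtr : (Pr x * ρ' x).trace = 0 :=
    (trace_mul_deriv_eq_trace_deriv hP' (hρ' x) hPP hPρ hρP).trans htr'
  simp [hPk, Matrix.add_mul, Matrix.sub_mul, htr', hPtr]
end

section
/- ρ is quasi-pure at x if and only if both of the following hold: (i) q_n'(x) = 0 for every n = 1,…,r; and (ii) for every pair k ≠ l in {1,…,r}, either q_k(x) = q_l(x) or ⟨φ_k'(x), φ_l(x)⟩ = 0. -/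
open Matrix
open scoped Classical

/-- Product rule for the bilinear dot product of coordinatewise differentiable vectors. -/
theorem hasDerivAt_dotProduct {n : Type*} [Fintype n] {u v : ℝ → n → ℂ} {u' v' : n → ℂ} {x : ℝ}
    (hu : ∀ i, HasDerivAt (fun y => u y i) (u' i) x)
    (hv : ∀ i, HasDerivAt (fun y => v y i) (v' i) x) :
    HasDerivAt (fun y => u y ⬝ᵥ v y) (u' ⬝ᵥ v x + u x ⬝ᵥ v') x := by
  simp only [dotProduct, ← Finset.sum_add_distrib]
  exact HasDerivAt.fun_sum fun i _ => (hu i).mul (hv i)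

section SpectralSum

variable {n ι : Type*} [Fintype n] [Fintype ι] [DecidableEq ι] {φ : ι → n → ℂ} {q : ι → ℂ}

theorem spectralSum_mulVec (hφ : ∀ k l, star (φ k) ⬝ᵥ φ l = if k = l then 1 else 0) (l : ι) :
    (∑ m, q m • ketbra (φ m) (φ m)) *ᵥ φ l = q l • φ l := by
  simp [ketbra, Matrix.sum_mulVec, Matrix.smul_mulVec, Matrix.vecMulVec_mulVec, hφ]

theorem vecMul_spectralSum (hφ : ∀ k l, star (φ k) ⬝ᵥ φ l = if k = l then 1 else 0) (k : ι) :
    star (φ k) ᵥ* (∑ m, q m • ketbra (φ m) (φ m)) = q k • star (φ k) := by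
  simp [ketbra, Matrix.vecMul_sum, Matrix.vecMul_smul, Matrix.vecMul_vecMulVec, hφ]

end SpectralSum

/-- Antisymmetry of the connection coefficients of a differentiable orthonormal frame. -/
theorem star_dotProduct_deriv {n ι : Type*} [Fintype n] [DecidableEq ι] {φ : ι → ℝ → n → ℂ} {φ' : ι → n → ℂ}
    {x : ℝ} (hortho : ∀ y k l, star (φ k y) ⬝ᵥ φ l y = if k = l then 1 else 0)
    (hφ' : ∀ k i, HasDerivAt (fun y => φ k y i) (φ' k i) x) (k l : ι) :
    star (φ k x) ⬝ᵥ φ' l = -(star (φ' k) ⬝ᵥ φ l x) := by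
  have h := hasDerivAt_dotProduct (u := fun y => star (φ k y)) (u' := star (φ' k))
    (fun i => (hφ' k i).star) (hφ' l)
  simp only [hortho] at h
  exact eq_neg_of_add_eq_zero_right (h.unique (hasDerivAt_const x _))

/-- Matrix elements, in the eigenbasis, of the derivative of a family in spectral form. -/
theorem star_dotProduct_deriv_mulVec {n ι : Type*} [Fintype n] [Fintype ι] [DecidableEq ι]
    {ρ : ℝ → Matrix n n ℂ} {q : ι → ℝ → ℝ} {φ : ι → ℝ → n → ℂ}
    (hortho : ∀ y k l, star (φ k y) ⬝ᵥ φ l y = if k = l then 1 else 0)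
    (hspec : ∀ y, ρ y = ∑ m, (q m y : ℂ) • ketbra (φ m y) (φ m y))
    {x : ℝ} {q' : ι → ℝ} (hq' : ∀ m, HasDerivAt (q m) (q' m) x)
    {φ' : ι → n → ℂ} (hφ' : ∀ m i, HasDerivAt (fun y => φ m y i) (φ' m i) x)
    {ρ' : Matrix n n ℂ} (hρ' : ∀ i j, HasDerivAt (fun y => ρ y i j) (ρ' i j) x) (k l : ι) :
    star (φ k x) ⬝ᵥ (ρ' *ᵥ φ l x) =
      (if k = l then (q' l : ℂ) else 0) + ((q k x : ℂ) - q l x) * (star (φ' k) ⬝ᵥ φ l x) := by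
  have hconst : ∀ i, HasDerivAt (fun _ : ℝ => star (φ k x) i) ((0 : n → ℂ) i) x :=
    fun i => hasDerivAt_const x _
  have hL := hasDerivAt_dotProduct hconst (v := fun y => ρ y *ᵥ φ l y)
    (fun i => hasDerivAt_dotProduct (hρ' i) (hφ' l))
  have hR := (hq' l).ofReal_comp.mul (hasDerivAt_dotProduct hconst (hφ' l))
  have hfun : (fun y => star (φ k x) ⬝ᵥ (ρ y *ᵥ φ l y)) =
      (fun y => (q l y : ℂ)) * fun y => star (φ k x) ⬝ᵥ φ l y := by
    ext y
    rw [hspec y, spectralSum_mulVec (hortho y), dotProduct_smul, smul_eq_mul, Pi.mul_apply]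
  rw [hfun] at hL
  have hadj : star (φ k x) ⬝ᵥ (ρ x *ᵥ φ' l) = q k x * (star (φ k x) ⬝ᵥ φ' l) := by
    rw [dotProduct_mulVec, hspec x, vecMul_spectralSum (hortho x), smul_dotProduct, smul_eq_mul]
  have h := hL.unique hR
  change 0 ⬝ᵥ _ + star (φ k x) ⬝ᵥ (ρ' *ᵥ φ l x + ρ x *ᵥ φ' l) = _ at h
  rw [zero_dotProduct, zero_add, dotProduct_add, hadj, zero_dotProduct, zero_add, hortho,
    star_dotProduct_deriv hortho hφ', mul_ite, mul_one, mul_zero] at h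
  linear_combination h

/-- A family `ρ(x) = ∑ₙ qₙ(x) |φₙ(x)⟩⟨φₙ(x)|` of density matrices is
quasi-pure at `x` (i.e. `⟨φₖ(x), ρ'(x) φₗ(x)⟩ = 0` for all `k, l`) if and only if
(i) `qₙ'(x) = 0` for every `n`, and (ii) for every pair `k ≠ l`, either `qₖ(x) = qₗ(x)`
or `⟨φₖ'(x), φₗ(x)⟩ = 0`. -/
theorem quasiPure_iff_spectral_criteria
    {d r : ℕ}
    (ρ : ℝ → Matrix (Fin d) (Fin d) ℂ)
    (q : Fin r → ℝ → ℝ) (φ : Fin r → ℝ → Fin d → ℂ)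
    (hortho : ∀ x m n, star (φ m x) ⬝ᵥ φ n x = if m = n then 1 else 0)
    (hqpos : ∀ x n, 0 < q n x)
    (hqsum : ∀ x, ∑ n, q n x = 1)
    (hspec : ∀ x, ρ x = ∑ n, (q n x : ℂ) • ketbra (φ n x) (φ n x))
    (x : ℝ)
    (q' : Fin r → ℝ) (hq' : ∀ n, HasDerivAt (q n) (q' n) x)
    (φ' : Fin r → Fin d → ℂ)
    (hφ' : ∀ n i, HasDerivAt (fun y => φ n y i) (φ' n i) x)
    (ρ' : Matrix (Fin d) (Fin d) ℂ)
    (hρ' : ∀ i j, HasDerivAt (fun y => ρ y i j) (ρ' i j) x) :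
    (∀ k l, star (φ k x) ⬝ᵥ (ρ' *ᵥ φ l x) = 0) ↔
      ((∀ n, q' n = 0) ∧
       ∀ k l, k ≠ l → (q k x = q l x ∨ star (φ' k) ⬝ᵥ φ l x = 0)) := by
  simp only [star_dotProduct_deriv_mulVec hortho hspec hq' hφ' hρ']
  constructor
  · refine fun h => ⟨fun m => by simpa using h m m, fun k l hkl => ?_⟩
    simpa [hkl, sub_eq_zero] using h k l
  · rintro ⟨hq, hφ⟩ k l
    rcases eq_or_ne k l with rfl | hkl
    · simp [hq]
    · simpa [hkl, sub_eq_zero] using hφ k l hkl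
end

section
/- The following two conditions are equivalent at x: (a) for every pair k ≠ l in {1,…,r}, either q_k(x) = q_l(x) or ⟨φ_k'(x), φ_l(x)⟩ = 0; (b) ⟨𝒟φ_k(x), φ_l(x)⟩ = 0 for all k, l = 1,…,r, where 𝒟φ_n(x) is the generalized covariant derivative. -/
open Matrix
open scoped Classical

/-- Subtracting from `v` its components along the members of an orthonormal family indexed by `s`
removes the overlap with each of these members and leaves the overlap with the others unchanged. -/
lemma star_sub_sum_dotProduct_of_orthonormal {ι n : Type*} [DecidableEq ι] [Fintype n]
    (e : ι → n → ℂ)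
    (he : ∀ i j, star (e i) ⬝ᵥ e j = if i = j then 1 else 0) (s : Finset ι) (v : n → ℂ) (l : ι) :
    star (v - ∑ m ∈ s, (star (e m) ⬝ᵥ v) • e m) ⬝ᵥ e l =
      if l ∈ s then 0 else star v ⬝ᵥ e l := by
  have hconj : star (star (e l) ⬝ᵥ v) = star v ⬝ᵥ e l := by
    rw [← Matrix.star_dotProduct_star, star_star, dotProduct_comm]
  simp only [star_sub, star_sum, star_smul, sub_dotProduct, sum_dotProduct, smul_dotProduct, he,
    smul_eq_mul, mul_ite, mul_one, mul_zero, Finset.sum_ite_eq', hconj]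
  split_ifs <;> simp

/-- For a family `ρ(x) = ∑ₙ qₙ(x) |φₙ(x)⟩⟨φₙ(x)|` of density matrices,
the following are equivalent at `x`: (a) for every pair `k ≠ l`, either `qₖ(x) = qₗ(x)` or
`⟨φₖ'(x), φₗ(x)⟩ = 0`; (b) `⟨𝒟φₖ(x), φₗ(x)⟩ = 0` for all `k, l`, where
`𝒟φₙ(x) = φₙ'(x) − Πₙ(x) φₙ'(x)` is the generalized covariant derivative and `Πₙ(x)` is the
orthogonal projection onto the degenerate eigenspace `span{φₘ(x) : qₘ(x) = qₙ(x)}`. -/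
theorem pairwise_criterion_iff_generalized_covariant_derivative
    {d r : ℕ}
    (ρ : ℝ → Matrix (Fin d) (Fin d) ℂ)
    (q : Fin r → ℝ → ℝ) (φ : Fin r → ℝ → Fin d → ℂ)
    (hortho : ∀ x m n, star (φ m x) ⬝ᵥ φ n x = if m = n then 1 else 0)
    (hqpos : ∀ x n, 0 < q n x)
    (hqsum : ∀ x, ∑ n, q n x = 1)
    (hspec : ∀ x, ρ x = ∑ n, (q n x : ℂ) • ketbra (φ n x) (φ n x))
    (x : ℝ)
    (q' : Fin r → ℝ) (hq' : ∀ n, HasDerivAt (q n) (q' n) x)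
    (φ' : Fin r → Fin d → ℂ)
    (hφ' : ∀ n i, HasDerivAt (fun y => φ n y i) (φ' n i) x)
    (Dφ : Fin r → Fin d → ℂ)
    (hDφ : ∀ n, Dφ n = φ' n - ∑ m ∈ Finset.univ.filter (fun m => q m x = q n x),
        (star (φ m x) ⬝ᵥ φ' n) • φ m x) :
    (∀ k l, k ≠ l → (q k x = q l x ∨ star (φ' k) ⬝ᵥ φ l x = 0)) ↔
      (∀ k l, star (Dφ k) ⬝ᵥ φ l x = 0) := by
  have key (k l : Fin r) : star (Dφ k) ⬝ᵥ φ l x =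
      if q l x = q k x then 0 else star (φ' k) ⬝ᵥ φ l x := by
    rw [hDφ, star_sub_sum_dotProduct_of_orthonormal (fun m => φ m x) (hortho x)]
    simp
  simp only [key, ite_eq_left_iff]
  refine forall₂_congr fun k l => ⟨fun h hq => ?_, fun h _ => ?_⟩
  · exact (h fun hkl => hq (by rw [hkl])).resolve_left (Ne.symm hq)
  · exact or_iff_not_imp_left.2 fun hq => h (Ne.symm hq)
end

section
/- Assume ρ is quasi-pure at x. Then the matrix L(x) = 2 Σ_{n=1}^{r} ( |𝒟φ_n(x)⟩⟨φ_n(x)| + |φ_n(x)⟩⟨𝒟φ_n(x)| ) is Hermitian and is an SLD of ρ at x, i.e. ρ'(x) = (L(x) ρ(x) + ρ(x) L(x))/2. -/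
open Matrix
open scoped Classical

section ketbra

variable {n : Type*}

lemma ketbra_apply (v w : n → ℂ) (i j : n) : ketbra v w i j = v i * star (w j) := rfl

lemma conjTranspose_ketbra (v w : n → ℂ) : (ketbra v w)ᴴ = ketbra w v := by
  ext i j
  simp [ketbra_apply, mul_comm]

lemma ketbra_mul_ketbra_s8 [Fintype n] (u v w z : n → ℂ) :
    ketbra u v * ketbra w z = (star v ⬝ᵥ w) • ketbra u z := by
  simp [ketbra, Matrix.vecMulVec_mul_vecMulVec, Matrix.vecMulVec_smul]

lemma ketbra_mulVec [Fintype n] (u v w : n → ℂ) :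
    ketbra u v *ᵥ w = (star v ⬝ᵥ w) • u := by
  ext i
  simp [ketbra, Matrix.vecMulVec_mulVec, mul_comm]

/-- The differentiated form of the constancy of the scalar product of two families of vectors. -/
lemma star_dotProduct_deriv_add_eq_zero [Fintype n] {u v : ℝ → n → ℂ} {u' v' : n → ℂ} {x : ℝ}
    {a : ℂ} (hu : ∀ i, HasDerivAt (fun y => u y i) (u' i) x)
    (hv : ∀ i, HasDerivAt (fun y => v y i) (v' i) x)
    (h : ∀ y, star (u y) ⬝ᵥ v y = a) :
    star u' ⬝ᵥ v x + star (u x) ⬝ᵥ v' = 0 := by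
  have h1 : HasDerivAt (fun y => ∑ i, star (u y i) * v y i)
      (∑ i, (star (u' i) * v x i + star (u x i) * v' i)) x :=
    HasDerivAt.fun_sum fun i _ => (hu i).star.mul (hv i)
  have h2 : (fun y => ∑ i, star (u y i) * v y i) = fun _ => a := funext h
  rw [h2] at h1
  have h3 := h1.unique (hasDerivAt_const x a)
  rwa [Finset.sum_add_distrib] at h3

/-- The product rule for a weighted sum of rank-one projections. -/
lemma hasDerivAt_sum_smul_ketbra {ι : Type*} [Fintype ι] {q : ι → ℝ → ℝ} {φ : ι → ℝ → n → ℂ}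
    {q' : ι → ℝ} {φ' : ι → n → ℂ} {x : ℝ} (hq : ∀ k, HasDerivAt (q k) (q' k) x)
    (hφ : ∀ k i, HasDerivAt (fun y => φ k y i) (φ' k i) x) (i j : n) :
    HasDerivAt (fun y => (∑ k, (q k y : ℂ) • ketbra (φ k y) (φ k y)) i j)
      ((∑ k, ((q' k : ℂ) • ketbra (φ k x) (φ k x) +
        (q k x : ℂ) • (ketbra (φ' k) (φ k x) + ketbra (φ k x) (φ' k)))) i j) x := by
  simp only [Matrix.sum_apply, Matrix.add_apply, Matrix.smul_apply, ketbra_apply, smul_eq_mul]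
  exact HasDerivAt.fun_sum fun k _ => (hq k).ofReal_comp.mul ((hφ k i).mul (hφ k j).star)

end ketbra

/-- If `ρ(x) = ∑ₙ qₙ(x)|φₙ(x)⟩⟨φₙ(x)|` is quasi-pure at `x`, then
`L(x) = 2 ∑ₙ (|𝒟φₙ(x)⟩⟨φₙ(x)| + |φₙ(x)⟩⟨𝒟φₙ(x)|)` is Hermitian and is an SLD of `ρ` at `x`:
`ρ'(x) = (L(x) ρ(x) + ρ(x) L(x))/2`. Here `𝒟φₙ(x) = φₙ'(x) − Πₙ(x)φₙ'(x)` with `Πₙ(x)` the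
projection onto the degenerate eigenspace `span{φₘ(x) : qₘ(x) = qₙ(x)}`. -/
theorem sld_of_quasiPure
    {d r : ℕ}
    (ρ : ℝ → Matrix (Fin d) (Fin d) ℂ)
    (q : Fin r → ℝ → ℝ) (φ : Fin r → ℝ → Fin d → ℂ)
    (hortho : ∀ x m n, star (φ m x) ⬝ᵥ φ n x = if m = n then 1 else 0)
    (hqpos : ∀ x n, 0 < q n x)
    (hqsum : ∀ x, ∑ n, q n x = 1)
    (hspec : ∀ x, ρ x = ∑ n, (q n x : ℂ) • ketbra (φ n x) (φ n x))
    (x : ℝ)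
    (q' : Fin r → ℝ) (hq' : ∀ n, HasDerivAt (q n) (q' n) x)
    (φ' : Fin r → Fin d → ℂ)
    (hφ' : ∀ n i, HasDerivAt (fun y => φ n y i) (φ' n i) x)
    (ρ' : Matrix (Fin d) (Fin d) ℂ)
    (hρ' : ∀ i j, HasDerivAt (fun y => ρ y i j) (ρ' i j) x)
    (hquasipure : ∀ k l, star (φ k x) ⬝ᵥ (ρ' *ᵥ φ l x) = 0)
    (Dφ : Fin r → Fin d → ℂ)
    (hDφ : ∀ n, Dφ n = φ' n - ∑ m ∈ Finset.univ.filter (fun m => q m x = q n x),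
        (star (φ m x) ⬝ᵥ φ' n) • φ m x)
    (L : Matrix (Fin d) (Fin d) ℂ)
    (hLdef : L = (2 : ℂ) • ∑ n, (ketbra (Dφ n) (φ n x) + ketbra (φ n x) (Dφ n))) :
    L.IsHermitian ∧ ρ' = (1/2 : ℂ) • (L * ρ x + ρ x * L) := by
  set c : Fin r → Fin r → ℂ := fun m n => star (φ m x) ⬝ᵥ φ' n with hc
  have hρ'_eq : ρ' = ∑ n, ((q' n : ℂ) • ketbra (φ n x) (φ n x) +
      (q n x : ℂ) • (ketbra (φ' n) (φ n x) + ketbra (φ n x) (φ' n))) := by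
    ext i j
    refine (hρ' i j).unique ?_
    simpa only [hspec] using hasDerivAt_sum_smul_ketbra hq' hφ' i j
  have hskew : ∀ m n, star (φ' m) ⬝ᵥ φ n x = -c m n := fun m n =>
    eq_neg_of_add_eq_zero_left
      (star_dotProduct_deriv_add_eq_zero (hφ' m) (hφ' n) fun y => hortho y m n)
  have hconj : ∀ m n, star (c m n) = -c n m := fun m n => by
    rw [← hskew, Matrix.star_dotProduct]
  have hentry : ∀ k l, (if k = l then (q' k : ℂ) else 0) + (q l x : ℂ) * c k l
      - (q k x : ℂ) * c k l = 0 := fun k l => by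
    refine Eq.trans ?_ (hquasipure k l)
    rw [hρ'_eq]
    simp only [Matrix.sum_mulVec, Matrix.add_mulVec, Matrix.smul_mulVec, ketbra_mulVec,
      dotProduct_sum, dotProduct_add, dotProduct_smul, hortho, hskew, smul_eq_mul,
      Finset.sum_add_distrib, mul_add, mul_ite, ite_mul, mul_one, mul_zero, one_mul, zero_mul,
      Finset.sum_ite_eq, Finset.sum_ite_eq', Finset.mem_univ, if_true]
    by_cases h : k = l
    · subst h
      simp [hc]
    · simp [h, hc]
      ring
  have hq'_zero : ∀ k, (q' k : ℂ) = 0 := fun k => by simpa using hentry k k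
  have hcomm : ∀ k l, (q l x : ℂ) * c k l = (q k x : ℂ) * c k l := fun k l => by
    have := hentry k l
    simp only [hq'_zero, ite_self, zero_add] at this
    exact sub_eq_zero.mp this
  have hc_zero : ∀ k l, q k x ≠ q l x → c k l = 0 := fun k l hkl => by
    by_contra h
    exact hkl (by exact_mod_cast (mul_right_cancel₀ h (hcomm k l)).symm)
  have hD : ∀ n, Dφ n = φ' n - ∑ m, c m n • φ m x := fun n => by
    rw [hDφ, Finset.sum_filter]
    congr 1
    refine Finset.sum_congr rfl fun m _ => ?_
    split_ifs with h
    · rfl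
    · rw [hc_zero m n h, zero_smul]
  have hperp : ∀ k n, star (φ k x) ⬝ᵥ Dφ n = 0 := fun k n => by
    simp [hD, dotProduct_sub, dotProduct_sum, hortho, hc]
  have hperp' : ∀ k n, star (Dφ n) ⬝ᵥ φ k x = 0 := fun k n => by
    rw [Matrix.star_dotProduct, hperp, star_zero]
  have hLρ : L * ρ x = (2 : ℂ) • ∑ n, (q n x : ℂ) • ketbra (Dφ n) (φ n x) := by
    simp [hLdef, hspec, Finset.sum_mul_sum, add_mul, ketbra_mul_ketbra_s8, hortho, hperp']
  have hρL : ρ x * L = (2 : ℂ) • ∑ n, (q n x : ℂ) • ketbra (φ n x) (Dφ n) := by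
    simp [hLdef, hspec, Finset.sum_mul_sum, mul_add, ketbra_mul_ketbra_s8, hortho, hperp]
  refine ⟨?_, ?_⟩
  · rw [Matrix.IsHermitian, hLdef]
    simp [Matrix.conjTranspose_sum, Matrix.conjTranspose_smul, conjTranspose_ketbra, add_comm]
  · have hket : ∀ n, ketbra (Dφ n) (φ n x) =
        ketbra (φ' n) (φ n x) - ∑ m, c m n • ketbra (φ m x) (φ n x) := fun n => by
      ext i j
      simp [hD, ketbra_apply, Matrix.sum_apply, sub_mul, Finset.sum_mul, mul_assoc]
    have hbra : ∀ n, ketbra (φ n x) (Dφ n) =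
        ketbra (φ n x) (φ' n) + ∑ m, c n m • ketbra (φ n x) (φ m x) := fun n => by
      rw [← conjTranspose_ketbra, hket]
      simp [Matrix.conjTranspose_sum, Matrix.conjTranspose_smul, conjTranspose_ketbra, hconj]
    have hcancel : ∑ n, (q n x : ℂ) • ∑ m, c m n • ketbra (φ m x) (φ n x) =
        ∑ n, (q n x : ℂ) • ∑ m, c n m • ketbra (φ n x) (φ m x) := by
      simp only [Finset.smul_sum, smul_smul]
      rw [Finset.sum_comm]
      simp only [hcomm]
    rw [hLρ, hρL, ← smul_add, smul_smul, hρ'_eq]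
    simp only [hq'_zero, zero_smul, zero_add, hket, hbra, smul_add, smul_sub,
      Finset.sum_add_distrib, Finset.sum_sub_distrib, hcancel]
    norm_num
end

section
/- Let U : ℝ → Matrix (Fin d) (Fin d) ℂ be a differentiable family of unitary matrices, ρ_i = Σ_{n=1}^{r} q_n |φ_n⟩⟨φ_n| with φ_1,…,φ_r orthonormal, q_n > 0, Σ_n q_n = 1, ρ(x) = U(x) ρ_i U(x)†, and H(x) = i · U'(x)† U(x). If ρ is quasi-pure at x, then for every SLD L of ρ at x, Tr[ρ(x) L²] = 4 [ Σ_{k=1}^{r} q_k ( ⟨φ_k, H(x)² φ_k⟩ − ⟨φ_k, H(x) φ_k⟩² ) − Σ_{k ≠ l, q_k = q_l} q_k |⟨φ_k, H(x) φ_l⟩|² ]. -/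
open Matrix
open scoped Classical

theorem HasDerivAt.matrix_mul_apply {l m n : Type*} [Fintype m]
    {A : ℝ → Matrix l m ℂ} {A' : Matrix l m ℂ} {B : ℝ → Matrix m n ℂ} {B' : Matrix m n ℂ} {x : ℝ}
    (hA : ∀ i j, HasDerivAt (fun y => A y i j) (A' i j) x)
    (hB : ∀ i j, HasDerivAt (fun y => B y i j) (B' i j) x) (i : l) (j : n) :
    HasDerivAt (fun y => (A y * B y) i j) ((A' * B x + A x * B') i j) x := by
  simp only [Matrix.mul_apply, Matrix.add_apply, ← Finset.sum_add_distrib]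
  exact HasDerivAt.fun_sum fun k _ => (hA i k).mul (hB k j)

theorem HasDerivAt.matrix_conjTranspose_apply {m n : Type*}
    {A : ℝ → Matrix m n ℂ} {A' : Matrix m n ℂ} {x : ℝ}
    (hA : ∀ i j, HasDerivAt (fun y => A y i j) (A' i j) x) (i : n) (j : m) :
    HasDerivAt (fun y => (A y)ᴴ i j) (A'ᴴ i j) x :=
  (hA j i).star

/-- The derivative of a differentiable family of unitaries is skew-adjoint after translation
to the identity. -/
theorem conjTranspose_deriv_mul_add_eq_zero {n : Type*} [Fintype n] [DecidableEq n]
    {U : ℝ → Matrix n n ℂ} {U' : Matrix n n ℂ} {x : ℝ}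
    (hU : ∀ y, U y ∈ Matrix.unitaryGroup n ℂ)
    (hU' : ∀ i j, HasDerivAt (fun y => U y i j) (U' i j) x) :
    U'ᴴ * U x + (U x)ᴴ * U' = 0 := by
  ext i j
  have h := HasDerivAt.matrix_mul_apply (HasDerivAt.matrix_conjTranspose_apply hU') hU' i j
  have hone (y : ℝ) : (U y)ᴴ * U y = 1 := Matrix.mem_unitaryGroup_iff'.mp (hU y)
  simp only [hone] at h
  exact h.unique (hasDerivAt_const x _)

/-- The matrix whose columns are the vectors `φ k`. -/
def columnMatrix {m n : Type*} (φ : m → n → ℂ) : Matrix n m ℂ :=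
  (Matrix.of φ)ᵀ

theorem columnMatrix_conjTranspose_mul_apply {m n : Type*} [Fintype n]
    (φ : m → n → ℂ) (k l : m) :
    ((columnMatrix φ)ᴴ * columnMatrix φ) k l = star (φ k) ⬝ᵥ φ l := rfl

theorem columnMatrix_conjTranspose_mul_mul_apply {m n : Type*} [Fintype n]
    (φ : m → n → ℂ) (A : Matrix n n ℂ) (k l : m) :
    ((columnMatrix φ)ᴴ * A * columnMatrix φ) k l = star (φ k) ⬝ᵥ (A *ᵥ φ l) := by
  rw [Matrix.mul_assoc]
  rfl

theorem mul_columnMatrix {m n : Type*} [Fintype n]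
    (φ : m → n → ℂ) (A : Matrix n n ℂ) :
    A * columnMatrix φ = columnMatrix fun k => A *ᵥ φ k := rfl

theorem columnMatrix_mul_diagonal_mul_conjTranspose {m n : Type*} [Fintype m]
    [DecidableEq m] (φ : m → n → ℂ) (w : m → ℂ) :
    columnMatrix φ * Matrix.diagonal w * (columnMatrix φ)ᴴ = ∑ k, w k • ketbra (φ k) (φ k) := by
  ext i j
  rw [Matrix.mul_apply, Matrix.sum_apply]
  simp only [Matrix.mul_diagonal, Matrix.smul_apply, ketbra, Matrix.vecMulVec_apply,
    columnMatrix, Matrix.transpose_apply, Matrix.conjTranspose_apply, Matrix.of_apply,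
    Pi.star_apply, smul_eq_mul]
  exact Finset.sum_congr rfl fun k _ => by ring

section quasiPure

variable {m n : Type*} [Fintype m] [DecidableEq m] [Fintype n]
  {V : Matrix n m ℂ} {q : m → ℝ} {H M : Matrix n n ℂ}

/-- A block that anticommutes with a positive diagonal matrix vanishes. -/
theorem eq_zero_of_mul_diagonal_add {B : Matrix m m ℂ} (hq : ∀ k, 0 < q k)
    (h : B * Matrix.diagonal (fun k => (q k : ℂ)) + Matrix.diagonal (fun k => (q k : ℂ)) * B = 0) :
    B = 0 := by
  ext k l
  have hkl := congrFun (congrFun h k) l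
  simp only [Matrix.add_apply, Matrix.mul_diagonal, Matrix.diagonal_mul, Matrix.zero_apply] at hkl
  have hne : ((q k + q l : ℝ) : ℂ) ≠ 0 := by
    exact_mod_cast (add_pos (hq k) (hq l)).ne'
  refine (mul_eq_zero.mp (?_ : ((q k + q l : ℝ) : ℂ) * B k l = 0)).resolve_left hne
  push_cast
  linear_combination hkl

/-- If the commutator `i[H, ρ]` of `ρ = V D Vᴴ` vanishes on the range of `V`, then
`D` commutes with `Vᴴ H V`, and a symmetric logarithmic derivative `M` acts on the range of `V`
as `2i(1 - V Vᴴ)H`. -/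
theorem quasiPure_commute_and_mul_eq (hV : Vᴴ * V = 1) (hq : ∀ k, 0 < q k)
    {D : Matrix m m ℂ} (hD : D = Matrix.diagonal fun k => (q k : ℂ))
    (hM : M * (V * D * Vᴴ) + (V * D * Vᴴ) * M
      = (2 * Complex.I) • (H * (V * D * Vᴴ) - (V * D * Vᴴ) * H))
    (hpure : Vᴴ * (M * (V * D * Vᴴ) + (V * D * Vᴴ) * M) * V = 0) :
    (Vᴴ * H * V) * D = D * (Vᴴ * H * V) ∧
      M * V = (2 * Complex.I) • (H * V - V * (Vᴴ * H * V)) := by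
  have right (X : Matrix n n ℂ) : X * (V * D * Vᴴ) * V = X * V * D := by
    simp only [Matrix.mul_assoc, hV, Matrix.mul_one]
  have left (X : Matrix n n ℂ) : Vᴴ * (V * D * Vᴴ * X * V) = D * (Vᴴ * X * V) := by
    simp only [← Matrix.mul_assoc, hV, Matrix.one_mul]
  have hB : Vᴴ * M * V = 0 := by
    refine eq_zero_of_mul_diagonal_add hq ?_
    rw [← hD, ← hpure, Matrix.mul_assoc Vᴴ (_ + _), Matrix.add_mul, Matrix.mul_add, left, right]
    simp only [Matrix.mul_assoc]
  have hcomm : (Vᴴ * H * V) * D = D * (Vᴴ * H * V) := by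
    rw [hM, Matrix.mul_smul, Matrix.smul_mul, Matrix.mul_assoc, Matrix.sub_mul, Matrix.mul_sub,
      left, right] at hpure
    simpa only [Matrix.mul_assoc] using
      sub_eq_zero.mp ((smul_eq_zero.mp hpure).resolve_left (by simp))
  refine ⟨hcomm, ?_⟩
  have hMV := congrArg (· * V) hM
  simp only [Matrix.add_mul, Matrix.smul_mul, Matrix.sub_mul, right] at hMV
  have expand (X : Matrix n n ℂ) : V * D * Vᴴ * X * V = V * (D * (Vᴴ * X * V)) := by
    simp only [Matrix.mul_assoc]
  rw [expand, expand, hB, ← hcomm, Matrix.mul_zero, Matrix.mul_zero, add_zero,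
    ← Matrix.mul_assoc V, ← Matrix.sub_mul, ← Matrix.smul_mul] at hMV
  have hunit : IsUnit D := by
    rw [hD, Matrix.isUnit_diagonal, Pi.isUnit_iff]
    exact fun k => (Complex.ofReal_ne_zero.mpr (hq k).ne').isUnit
  obtain ⟨E, hE⟩ := hunit.exists_right_inv
  simpa only [Matrix.mul_assoc, hE, Matrix.mul_one] using congrArg (· * E) hMV

theorem trace_mul_sq_of_mul_eq (hV : Vᴴ * V = 1) (D : Matrix m m ℂ)
    (hH : H.IsHermitian) (hMh : M.IsHermitian)
    (hMV : M * V = (2 * Complex.I) • (H * V - V * (Vᴴ * H * V))) :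
    (V * D * Vᴴ * (M * M)).trace
      = 4 * (D * (Vᴴ * (H * H) * V - (Vᴴ * H * V) * (Vᴴ * H * V))).trace := by
  have hsq : Vᴴ * (M * M) * V = (M * V)ᴴ * (M * V) := by
    simp only [Matrix.conjTranspose_mul, hMh.eq, Matrix.mul_assoc]
  have hcancel (X : Matrix m m ℂ) : Vᴴ * (V * X) = X := by
    rw [← Matrix.mul_assoc, hV, Matrix.one_mul]
  have hblock : Vᴴ * (M * M) * V
      = (4 : ℂ) • (Vᴴ * (H * H) * V - (Vᴴ * H * V) * (Vᴴ * H * V)) := by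
    rw [hsq, hMV, Matrix.conjTranspose_smul, Matrix.smul_mul, Matrix.mul_smul, smul_smul]
    congr 1
    · simp only [star_mul', Complex.star_def, Complex.conj_I, map_ofNat]
      linear_combination (-4 : ℂ) * Complex.I_sq
    · simp only [Matrix.conjTranspose_sub, Matrix.conjTranspose_mul,
        Matrix.conjTranspose_conjTranspose, hH.eq, Matrix.sub_mul, Matrix.mul_sub,
        Matrix.mul_assoc, hcancel]
      abel
  calc (V * D * Vᴴ * (M * M)).trace = (D * (Vᴴ * (M * M) * V)).trace := by
        rw [Matrix.mul_assoc, Matrix.mul_assoc, Matrix.trace_mul_comm, Matrix.mul_assoc]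
    _ = _ := by rw [hblock, Matrix.mul_smul, Matrix.trace_smul, smul_eq_mul]

end quasiPure

/-- For Hermitian `A` commuting with `diagonal q`, the diagonal entries of `A²` split into the
squared diagonal entry and the off-diagonal entries between equal weights. -/
theorem mul_self_apply_diag_of_commute {m : Type*} [Fintype m] [DecidableEq m] {q : m → ℝ}
    {A : Matrix m m ℂ} (hA : A.IsHermitian)
    (hcomm : A * Matrix.diagonal (fun k => (q k : ℂ)) = Matrix.diagonal (fun k => (q k : ℂ)) * A)
    (k : m) :
    (A * A) k k = A k k ^ 2
      + ∑ l, if k ≠ l ∧ q k = q l then (Complex.normSq (A k l) : ℂ) else 0 := by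
  have hprod (l : m) : A k l * A l k = (Complex.normSq (A k l) : ℂ) := by
    rw [← hA.apply l k, Complex.star_def, Complex.mul_conj]
  have hzero (l : m) (h : q k ≠ q l) : A k l = 0 := by
    have hkl := congrFun (congrFun hcomm k) l
    simp only [Matrix.mul_diagonal, Matrix.diagonal_mul] at hkl
    refine (mul_eq_zero.mp (?_ : ((q k : ℂ) - q l) * A k l = 0)).resolve_left ?_
    · linear_combination -hkl
    · exact sub_ne_zero.mpr (by exact_mod_cast h)
  have hterm (l : m) : A k l * A l k = (if l = k then A k k ^ 2 else 0)
      + if k ≠ l ∧ q k = q l then (Complex.normSq (A k l) : ℂ) else 0 := by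
    rcases eq_or_ne l k with rfl | hlk
    · simp [sq]
    · by_cases hqkl : q k = q l
      · simp [hlk, hlk.symm, hqkl, hprod]
      · simp [hlk, hqkl, hzero l hqkl]
  rw [Matrix.mul_apply, Finset.sum_congr rfl fun l _ => hterm l, Finset.sum_add_distrib,
    Finset.sum_ite_eq' Finset.univ k, if_pos (Finset.mem_univ k)]

/-- Let `U(x)` be a differentiable family of unitaries,
`ρᵢ = ∑ₙ qₙ|φₙ⟩⟨φₙ|` with `φₙ` orthonormal, `qₙ > 0`, `∑ₙ qₙ = 1`,
`ρ(x) = U(x) ρᵢ U(x)†`, `H(x) = i U'(x)† U(x)`. If `ρ` is quasi-pure at `x`, then for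
every SLD `L` of `ρ` at `x`,
`Tr[ρ(x)L²] = 4[∑ₖ qₖ(⟨φₖ,H²φₖ⟩ − ⟨φₖ,Hφₖ⟩²) − ∑_{k≠l, qₖ=qₗ} qₖ|⟨φₖ,Hφₗ⟩|²]`. -/
theorem unitary_family_qfi_of_quasiPure
    {d r : ℕ}
    (U : ℝ → Matrix (Fin d) (Fin d) ℂ)
    (hU : ∀ x, U x ∈ Matrix.unitaryGroup (Fin d) ℂ)
    (U' : ℝ → Matrix (Fin d) (Fin d) ℂ)
    (hU' : ∀ x i j, HasDerivAt (fun y => U y i j) (U' x i j) x)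
    (q : Fin r → ℝ) (φ : Fin r → Fin d → ℂ)
    (hortho : ∀ m n, star (φ m) ⬝ᵥ φ n = if m = n then 1 else 0)
    (hqpos : ∀ n, 0 < q n) (hqsum : ∑ n, q n = 1)
    (ρi : Matrix (Fin d) (Fin d) ℂ)
    (hρi : ρi = ∑ n, (q n : ℂ) • ketbra (φ n) (φ n))
    (ρ : ℝ → Matrix (Fin d) (Fin d) ℂ)
    (hρ : ∀ x, ρ x = U x * ρi * (U x)ᴴ)
    (H : ℝ → Matrix (Fin d) (Fin d) ℂ)
    (hH : ∀ x, H x = Complex.I • ((U' x)ᴴ * U x))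
    (x : ℝ)
    (ρ' : Matrix (Fin d) (Fin d) ℂ)
    (hρ' : ∀ i j, HasDerivAt (fun y => ρ y i j) (ρ' i j) x)
    (hquasipure : ∀ k l, star (U x *ᵥ φ k) ⬝ᵥ (ρ' *ᵥ (U x *ᵥ φ l)) = 0)
    (L : Matrix (Fin d) (Fin d) ℂ)
    (hL : L.IsHermitian)
    (hSLD : ρ' = (1/2 : ℂ) • (L * ρ x + ρ x * L)) :
    (ρ x * L ^ 2).trace =
      4 * ((∑ k, (q k : ℂ) *
            ((star (φ k) ⬝ᵥ ((H x * H x) *ᵥ φ k)) - (star (φ k) ⬝ᵥ (H x *ᵥ φ k)) ^ 2))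
        - ∑ k, ∑ l, if k ≠ l ∧ q k = q l then
            (q k : ℂ) * (Complex.normSq (star (φ k) ⬝ᵥ (H x *ᵥ φ l)) : ℂ) else 0) := by
  have hUU : (U x)ᴴ * U x = 1 := Matrix.mem_unitaryGroup_iff'.mp (hU x)
  have hcancel (X : Matrix (Fin d) (Fin d) ℂ) : (U x)ᴴ * (U x * X) = X := by
    rw [← Matrix.mul_assoc, hUU, Matrix.one_mul]
  have hskew := conjTranspose_deriv_mul_add_eq_zero hU (hU' x)
  have hUdU : (U x)ᴴ * U' x = Complex.I • H x := by
    rw [hH, smul_smul, Complex.I_mul_I, neg_one_smul]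
    exact eq_neg_of_add_eq_zero_right hskew
  have hdUU : (U' x)ᴴ * U x = -(Complex.I • H x) := by
    rw [← hUdU]
    exact eq_neg_of_add_eq_zero_left hskew
  have hHherm : (H x).IsHermitian := by
    rw [Matrix.IsHermitian, hH, Matrix.conjTranspose_smul, Matrix.conjTranspose_mul,
      Matrix.conjTranspose_conjTranspose, eq_neg_of_add_eq_zero_right hskew]
    simp
  have hρ'_eq : ρ' = U' x * ρi * (U x)ᴴ + U x * ρi * (U' x)ᴴ := by
    ext i j
    have hUρ := HasDerivAt.matrix_mul_apply (hU' x) (B := fun _ => ρi) (B' := 0)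
      fun i j => hasDerivAt_const x (ρi i j)
    have h := HasDerivAt.matrix_mul_apply hUρ
      (HasDerivAt.matrix_conjTranspose_apply (hU' x)) i j
    simp only [Matrix.mul_zero, add_zero, ← hρ] at h
    exact (hρ' i j).unique h
  set V := columnMatrix φ with hVdef
  set D := Matrix.diagonal fun k => (q k : ℂ) with hD
  set M := (U x)ᴴ * L * U x with hMdef
  have hV : Vᴴ * V = 1 := by
    ext k l
    rw [hVdef, columnMatrix_conjTranspose_mul_apply, hortho, Matrix.one_apply]
  have hVDV : ρi = V * D * Vᴴ := by
    rw [hρi, hVdef, hD, columnMatrix_mul_diagonal_mul_conjTranspose]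
  have hpulled : (U x)ᴴ * ρ' * U x = Complex.I • (H x * ρi - ρi * H x) := by
    calc (U x)ᴴ * ρ' * U x
        = ((U x)ᴴ * U' x) * ρi + ρi * ((U' x)ᴴ * U x) := by
          simp only [hρ'_eq, Matrix.mul_add, Matrix.add_mul, Matrix.mul_assoc, hUU, hcancel,
            Matrix.mul_one]
      _ = _ := by
          rw [hUdU, hdUU, Matrix.smul_mul, Matrix.mul_neg, Matrix.mul_smul, smul_sub,
            sub_eq_add_neg]
  have hSLDpulled : M * ρi + ρi * M = (2 : ℂ) • ((U x)ᴴ * ρ' * U x) := by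
    rw [hSLD, Matrix.mul_smul, Matrix.smul_mul, smul_smul, hMdef, hρ]
    norm_num
    simp only [Matrix.mul_add, Matrix.add_mul, Matrix.mul_assoc, hUU, hcancel, Matrix.mul_one]
  have hpure : Vᴴ * (M * ρi + ρi * M) * V = 0 := by
    have h : (columnMatrix fun k => U x *ᵥ φ k)ᴴ * ρ' * columnMatrix (fun k => U x *ᵥ φ k) = 0 := by
      ext k l
      rw [columnMatrix_conjTranspose_mul_mul_apply, hquasipure, Matrix.zero_apply]
    rw [← mul_columnMatrix, Matrix.conjTranspose_mul, ← hVdef] at h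
    rw [hSLDpulled, Matrix.mul_smul, Matrix.smul_mul]
    simp only [Matrix.mul_assoc] at h ⊢
    rw [h, smul_zero]
  have hMcomm : M * ρi + ρi * M = (2 * Complex.I) • (H x * ρi - ρi * H x) := by
    rw [hSLDpulled, hpulled, smul_smul]
  have htrace : (ρ x * L ^ 2).trace = (ρi * (M * M)).trace := by
    have hUU' : U x * (U x)ᴴ = 1 := Matrix.mem_unitaryGroup_iff.mp (hU x)
    have hcancel' (X : Matrix (Fin d) (Fin d) ℂ) : U x * ((U x)ᴴ * X) = X := by
      rw [← Matrix.mul_assoc, hUU', Matrix.one_mul]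
    rw [hρ, hMdef, sq, Matrix.mul_assoc, Matrix.mul_assoc, Matrix.trace_mul_comm]
    simp only [Matrix.mul_assoc, hcancel']
  rw [hVDV] at hMcomm hpure
  obtain ⟨hcomm, hMV⟩ := quasiPure_commute_and_mul_eq hV hqpos hD hMcomm hpure
  have hMherm : M.IsHermitian := Matrix.isHermitian_conjTranspose_mul_mul (U x) hL
  have hAherm : (Vᴴ * H x * V).IsHermitian := Matrix.isHermitian_conjTranspose_mul_mul V hHherm
  rw [htrace, hVDV, trace_mul_sq_of_mul_eq hV D hHherm hMherm hMV, Matrix.trace,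
    ← Finset.sum_sub_distrib]
  congr 1
  refine Finset.sum_congr rfl fun k _ => ?_
  rw [Matrix.diag_apply, hD, Matrix.diagonal_mul, Matrix.sub_apply,
    mul_self_apply_diag_of_commute hAherm hcomm]
  simp only [hVdef, columnMatrix_conjTranspose_mul_mul_apply, ← mul_ite_zero, ← Finset.mul_sum]
  ring
end

section
/- Let φ_1, …, φ_r : ℝ → ℂ^d be differentiable families of unit vectors, let q_1, …, q_r > 0 be constants with Σ_n q_n = 1, let e_1, …, e_r be orthonormal vectors in ℂ^r (the ancilla), and define the classically correlated family σ(x) = Σ_{n=1}^{r} q_n |φ_n(x)⟩⟨φ_n(x)| ⊗ |e_n⟩⟨e_n| on ℂ^d ⊗ ℂ^r. Then σ is quasi-pure at every x: ⟨φ_k(x) ⊗ e_k, σ'(x) (φ_l(x) ⊗ e_l)⟩ = 0 for all k, l = 1,…,r and all x. -/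
open Matrix
open scoped Classical Kronecker

/-- The tensor (Kronecker) product `v ⊗ w` of vectors. -/
noncomputable def vtens {m n : Type*} (v : m → ℂ) (w : n → ℂ) : m × n → ℂ :=
  fun p => v p.1 * w p.2

lemma kronecker_mulVec_vtens {m n : Type*} [Fintype m] [Fintype n]
    (A : Matrix m m ℂ) (B : Matrix n n ℂ) (v : m → ℂ) (w : n → ℂ) :
    (A ⊗ₖ B) *ᵥ vtens v w = vtens (A *ᵥ v) (B *ᵥ w) := by
  ext ⟨i, j⟩
  simp only [mulVec, dotProduct, vtens, kroneckerMap_apply, Fintype.sum_prod_type,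
    Finset.sum_mul_sum]
  exact Finset.sum_congr rfl fun _ _ => Finset.sum_congr rfl fun _ _ => by ring

lemma star_vtens_dotProduct_vtens {m n : Type*} [Fintype m] [Fintype n]
    (v v' : m → ℂ) (w w' : n → ℂ) :
    star (vtens v w) ⬝ᵥ vtens v' w' = (star v ⬝ᵥ v') * (star w ⬝ᵥ w') := by
  simp only [dotProduct, vtens, Pi.star_apply, star_mul', Fintype.sum_prod_type,
    Finset.sum_mul_sum]
  exact Finset.sum_congr rfl fun _ _ => Finset.sum_congr rfl fun _ _ => by ring

lemma star_dotProduct_ketbra_mulVec {n : Type*} [Fintype n] (u v w z : n → ℂ) :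
    star u ⬝ᵥ (ketbra v w *ᵥ z) = (star u ⬝ᵥ v) * (star w ⬝ᵥ z) := by
  rw [ketbra, vecMulVec_mulVec, op_smul_eq_smul, dotProduct_smul, smul_eq_mul, mul_comm]

lemma HasDerivAt.dotProduct {n : Type*} [Fintype n] {f g : ℝ → n → ℂ} {f' g' : n → ℂ} {x : ℝ}
    (hf : ∀ i, HasDerivAt (fun y => f y i) (f' i) x)
    (hg : ∀ i, HasDerivAt (fun y => g y i) (g' i) x) :
    HasDerivAt (fun y => f y ⬝ᵥ g y) (f' ⬝ᵥ g x + f x ⬝ᵥ g') x := by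
  simp only [_root_.dotProduct, ← Finset.sum_add_distrib]
  exact HasDerivAt.fun_sum fun i _ => (hf i).mul (hg i)

/-- The overlap `⟨φ(x), φ(y)⟩⟨φ(y), φ(x)⟩` of a family of unit vectors is stationary at `y = x`. -/
lemma hasDerivAt_overlap_of_unit {n : Type*} [Fintype n] {φ : ℝ → n → ℂ} {φ' : n → ℂ} {x : ℝ}
    (hunit : ∀ y, star (φ y) ⬝ᵥ φ y = 1)
    (hφ : ∀ i, HasDerivAt (fun y => φ y i) (φ' i) x) :
    HasDerivAt (fun y => (star (φ x) ⬝ᵥ φ y) * (star (φ y) ⬝ᵥ φ x)) 0 x := by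
  have hstar : ∀ i, HasDerivAt (fun y => star (φ y) i) (star φ' i) x := fun i => (hφ i).star
  have hnorm : star φ' ⬝ᵥ φ x + star (φ x) ⬝ᵥ φ' = 0 := by
    refine (HasDerivAt.dotProduct hstar hφ).unique ?_
    simp only [hunit]
    exact hasDerivAt_const x 1
  have hright : HasDerivAt (fun y => star (φ x) ⬝ᵥ φ y) (star (φ x) ⬝ᵥ φ') x := by
    simpa using HasDerivAt.dotProduct (f' := 0) (fun i => hasDerivAt_const x (star (φ x) i)) hφ
  have hleft : HasDerivAt (fun y => star (φ y) ⬝ᵥ φ x) (star φ' ⬝ᵥ φ x) x := by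
    simpa using HasDerivAt.dotProduct (g' := 0) hstar (fun i => hasDerivAt_const x (φ x i))
  refine (hright.mul hleft).congr_deriv ?_
  rw [hunit, mul_one, one_mul, add_comm, hnorm]

/-- Let `φ₁, …, φᵣ : ℝ → ℂ^d` be differentiable families of unit vectors,
`q₁, …, qᵣ > 0` constants with `∑ₙ qₙ = 1`, `e₁, …, eᵣ` orthonormal ancilla vectors in
`ℂ^r`, and define the classically correlated family
`σ(x) = ∑ₙ qₙ |φₙ(x)⟩⟨φₙ(x)| ⊗ |eₙ⟩⟨eₙ|` on `ℂ^d ⊗ ℂ^r`. Then `σ` is quasi-pure at every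
`x`: `⟨φₖ(x) ⊗ eₖ, σ'(x) (φₗ(x) ⊗ eₗ)⟩ = 0` for all `k, l` and all `x`. -/
theorem classically_correlated_ancilla_family_is_quasiPure
    {d r : ℕ}
    (q : Fin r → ℝ) (hqpos : ∀ n, 0 < q n) (hqsum : ∑ n, q n = 1)
    (φ : Fin r → ℝ → Fin d → ℂ)
    (hunit : ∀ n x, star (φ n x) ⬝ᵥ φ n x = 1)
    (φ' : Fin r → ℝ → Fin d → ℂ)
    (hφ' : ∀ n x i, HasDerivAt (fun y => φ n y i) (φ' n x i) x)
    (e : Fin r → Fin r → ℂ)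
    (he : ∀ m n, star (e m) ⬝ᵥ e n = if m = n then 1 else 0)
    (σ : ℝ → Matrix (Fin d × Fin r) (Fin d × Fin r) ℂ)
    (hσ : ∀ x, σ x = ∑ n, (q n : ℂ) • (ketbra (φ n x) (φ n x) ⊗ₖ ketbra (e n) (e n)))
    (σ' : ℝ → Matrix (Fin d × Fin r) (Fin d × Fin r) ℂ)
    (hσ' : ∀ x i j, HasDerivAt (fun y => σ y i j) (σ' x i j) x) :
    ∀ (x : ℝ) (k l : Fin r),
      star (vtens (φ k x) (e k)) ⬝ᵥ (σ' x *ᵥ vtens (φ l x) (e l)) = 0 := by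
  intro x k l
  have hderiv : HasDerivAt
      (fun y => star (vtens (φ k x) (e k)) ⬝ᵥ (σ y *ᵥ vtens (φ l x) (e l)))
      (star (vtens (φ k x) (e k)) ⬝ᵥ (σ' x *ᵥ vtens (φ l x) (e l))) x := by
    have hmulVec : ∀ i, HasDerivAt (fun y => (σ y *ᵥ vtens (φ l x) (e l)) i)
        ((σ' x *ᵥ vtens (φ l x) (e l)) i) x := fun i =>
      HasDerivAt.fun_sum fun j _ => (hσ' x i j).mul_const _
    exact HasDerivAt.fun_sum fun i _ => (hmulVec i).const_mul _
  refine hderiv.unique ?_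
  have hentry : ∀ y, star (vtens (φ k x) (e k)) ⬝ᵥ (σ y *ᵥ vtens (φ l x) (e l)) =
      if k = l then (q k : ℂ) * ((star (φ k x) ⬝ᵥ φ k y) * (star (φ k y) ⬝ᵥ φ k x)) else 0 := by
    intro y
    simp only [hσ, sum_mulVec, dotProduct_sum, smul_mulVec, dotProduct_smul,
      kronecker_mulVec_vtens, star_vtens_dotProduct_vtens, star_dotProduct_ketbra_mulVec, he]
    rw [Finset.sum_eq_single k (fun n _ hn => by simp [hn.symm]) (by simp)]
    by_cases h : k = l
    · subst h
      simp
    · simp [h]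
  simp only [hentry]
  split_ifs
  · simpa using (hasDerivAt_overlap_of_unit (hunit k) (hφ' k x)).const_mul (q k : ℂ)
  · exact hasDerivAt_const x 0
end
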